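/- Let A and B be countable right-orderable groups, G = A ∗ B, and let w = a₁b₁⋯aₙbₙ ∈ G be a cyclically reduced word of length 2n with n ≥ 1. Then a relative stacking of w exists if and only if w is not a proper power (i.e., there do not exist v ∈ G and an integer j ≥ 2 with w = vʲ). -/

import Mathlib

/-- A group is right-orderable if there is a strict total order on it invariant
under right multiplication. -/
def IsRightOrderable (H : Type*) [Group H] : Prop :=
  ∃ lt : H → H → Prop, IsStrictTotalOrder H lt ∧ ∀ f g h : H, lt f g → lt (f * h) (g * h)

/-- A right action of `G` on `ℝ` by orientation-preserving homeomorphisms, i.e. a map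
to order-preserving bijections of `ℝ` satisfying `x·σ(gh) = (x·σ(g))·σ(h)`. -/
def IsRightAction {G : Type*} [Group G] (σ : G → (ℝ ≃o ℝ)) : Prop :=
  ∀ g h : G, σ (g * h) = (σ g).trans (σ h)

/-- The list of letters `a₁, b₁, …, aₙ, bₙ` of the word `w = a₁b₁⋯aₙbₙ` in `A ∗ B`. -/
def wordLetters {A B : Type*} [Group A] [Group B] {n : ℕ}
    (a : Fin n → A) (b : Fin n → B) : List (Monoid.Coprod A B) :=
  (List.finRange n).flatMap fun i => [Monoid.Coprod.inl (a i), Monoid.Coprod.inr (b i)]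

/-- A relative stacking of the cyclically reduced word `w = a₁b₁⋯aₙbₙ` is a right action
`σ` of `A ∗ B` on `ℝ` together with `x ∈ ℝ` such that `x·σ(w) = x` and the `2n` points
`x·σ(u)`, for `u` a nonempty prefix of `w`, are pairwise distinct. -/
def IsRelativeStacking {A B : Type*} [Group A] [Group B] {n : ℕ}
    (a : Fin n → A) (b : Fin n → B)
    (σ : Monoid.Coprod A B → (ℝ ≃o ℝ)) (x : ℝ) : Prop :=
  IsRightAction σ ∧
  σ ((wordLetters a b).prod) x = x ∧
  ∀ m₁ m₂ : ℕ, 1 ≤ m₁ → m₁ ≤ 2 * n → 1 ≤ m₂ → m₂ ≤ 2 * n →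
    σ (((wordLetters a b).take m₁).prod) x = σ (((wordLetters a b).take m₂).prod) x →
    m₁ = m₂

/-- Every order automorphism of `ℚ` extends to an order automorphism of `ℝ` with the same cuts. -/
lemma exists_real_forall_lt_iff (f : ℚ ≃o ℚ) (x : ℝ) :
    ∃ y : ℝ, ∀ q : ℚ, (q : ℝ) < x ↔ (f q : ℝ) < y := by
  have hne : ((fun q : ℚ => (f q : ℝ)) '' {q | (q : ℝ) < x}).Nonempty := by
    obtain ⟨q, hq⟩ := exists_rat_lt x
    exact ⟨_, q, hq, rfl⟩
  have hbd : BddAbove ((fun q : ℚ => (f q : ℝ)) '' {q | (q : ℝ) < x}) := by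
    obtain ⟨q, hq⟩ := exists_rat_gt x
    refine ⟨f q, ?_⟩
    rintro _ ⟨p, hp, rfl⟩
    have : p < q := by exact_mod_cast lt_trans hp hq
    exact Rat.cast_le.2 (f.lt_iff_lt.2 this).le
  refine ⟨sSup ((fun q : ℚ => (f q : ℝ)) '' {q | (q : ℝ) < x}), fun q =>
    ⟨fun hq => ?_, fun hq => ?_⟩⟩
  · obtain ⟨p, hp, hpx⟩ := exists_rat_btwn hq
    have h : q < p := by exact_mod_cast hp
    have h' : (f q : ℝ) < f p := by exact_mod_cast f.lt_iff_lt.2 h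
    exact lt_of_lt_of_le h' (le_csSup hbd ⟨p, hpx, rfl⟩)
  · obtain ⟨_, ⟨p, hp, rfl⟩, hqp⟩ := exists_lt_of_lt_csSup hne hq
    have h : q < p := by
      exact f.lt_iff_lt.1 (Rat.cast_lt.1 hqp)
    have h' : (q : ℝ) < p := by exact_mod_cast h
    exact lt_trans h' hp

lemma real_eq_of_forall_rat_lt_iff {x y : ℝ} (h : ∀ q : ℚ, (q : ℝ) < x ↔ (q : ℝ) < y) :
    x = y := by
  rcases lt_trichotomy x y with hxy | hxy | hxy
  · obtain ⟨q, hq, hq'⟩ := exists_rat_btwn hxy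
    exact absurd ((h q).2 hq') hq.not_gt
  · exact hxy
  · obtain ⟨q, hq, hq'⟩ := exists_rat_btwn hxy
    exact absurd ((h q).1 hq') hq.not_gt

/-- The extension of an order automorphism of `ℚ` to `ℝ`, as a function. -/
noncomputable def ratExtend (f : ℚ ≃o ℚ) (x : ℝ) : ℝ :=
  (exists_real_forall_lt_iff f x).choose

lemma lt_iff_lt_ratExtend (f : ℚ ≃o ℚ) (x : ℝ) (q : ℚ) :
    (q : ℝ) < x ↔ (f q : ℝ) < ratExtend f x :=
  (exists_real_forall_lt_iff f x).choose_spec q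

lemma ratExtend_mul (f g : ℚ ≃o ℚ) (x : ℝ) :
    ratExtend (f * g) x = ratExtend f (ratExtend g x) := by
  refine real_eq_of_forall_rat_lt_iff fun q => ?_
  obtain ⟨p, rfl⟩ := (f * g).surjective q
  rw [← lt_iff_lt_ratExtend]
  change _ ↔ (f (g p) : ℝ) < _
  rw [← lt_iff_lt_ratExtend, ← lt_iff_lt_ratExtend]

lemma ratExtend_one (x : ℝ) : ratExtend 1 x = x :=
  real_eq_of_forall_rat_lt_iff fun q => (lt_iff_lt_ratExtend 1 x q).symm

lemma ratExtend_ratCast (f : ℚ ≃o ℚ) (p : ℚ) : ratExtend f p = f p := by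
  refine real_eq_of_forall_rat_lt_iff fun q => ?_
  obtain ⟨r, rfl⟩ := f.surjective q
  rw [← lt_iff_lt_ratExtend]
  norm_cast
  exact f.lt_iff_lt.symm

lemma ratExtend_strictMono (f : ℚ ≃o ℚ) : StrictMono (ratExtend f) := by
  intro x y hxy
  obtain ⟨q, hq, hq'⟩ := exists_rat_btwn hxy
  exact lt_of_le_of_lt (not_lt.1 fun h => hq.not_gt ((lt_iff_lt_ratExtend f x q).2 h))
    ((lt_iff_lt_ratExtend f y q).1 hq')

/-- Extension of order automorphisms from `ℚ` to `ℝ`, as a group homomorphism. -/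
noncomputable def ratExtendHom : (ℚ ≃o ℚ) →* (ℝ ≃o ℝ) where
  toFun f := StrictMono.orderIsoOfRightInverse (ratExtend f) (ratExtend_strictMono f)
    (ratExtend f⁻¹) fun x => by rw [← ratExtend_mul, mul_inv_cancel, ratExtend_one]
  map_one' := by ext x; exact ratExtend_one x
  map_mul' f g := by ext x; exact ratExtend_mul f g x

lemma ratExtendHom_ratCast (f : ℚ ≃o ℚ) (p : ℚ) : ratExtendHom f (p : ℝ) = f p :=
  ratExtend_ratCast f p

/-- The diagonal action on a lexicographic product of two ordered sets, read in coordinates that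
are changed by `u s` in the fibre over `s`. -/
def lexAction {G S T : Type*} [Group G] [LinearOrder S] [LinearOrder T] (φ : G →* (S ≃o S))
    (ρ : G →* (T ≃o T)) (u : S → (T ≃o T)) : G →* (S ×ₗ T ≃o S ×ₗ T) where
  toFun g := StrictMono.orderIsoOfRightInverse
    (fun p => toLex (φ g (ofLex p).1, (u (φ g (ofLex p).1)).symm (ρ g (u (ofLex p).1 (ofLex p).2))))
    (by
      intro p q h
      rw [Prod.Lex.lt_iff] at h ⊢
      rcases h with h | ⟨h, h'⟩
      · exact Or.inl ((φ g).lt_iff_lt.2 h)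
      · refine Or.inr ⟨by simp [h], ?_⟩
        simpa [h] using h')
    (fun p => toLex (φ g⁻¹ (ofLex p).1,
      (u (φ g⁻¹ (ofLex p).1)).symm (ρ g⁻¹ (u (ofLex p).1 (ofLex p).2))))
    (by
      intro p
      have h1 : ∀ s, φ g ((φ g)⁻¹ s) = s := fun s => (φ g).apply_symm_apply s
      have h2 : ∀ s, ρ g ((ρ g)⁻¹ s) = s := fun s => (ρ g).apply_symm_apply s
      simp [h1, h2])
  map_one' := by ext p; simp
  map_mul' g h := by
    refine DFunLike.ext _ _ fun p => ?_
    change toLex (φ (g * h) (ofLex p).1,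
        (u (φ (g * h) (ofLex p).1)).symm (ρ (g * h) (u (ofLex p).1 (ofLex p).2))) =
      toLex (φ g (φ h (ofLex p).1), (u (φ g (φ h (ofLex p).1))).symm
        (ρ g (u (φ h (ofLex p).1) ((u (φ h (ofLex p).1)).symm
          (ρ h (u (ofLex p).1 (ofLex p).2))))))
    simp

lemma lexAction_apply {G S T : Type*} [Group G] [LinearOrder S] [LinearOrder T] (φ : G →* (S ≃o S))
    (ρ : G →* (T ≃o T)) (u : S → (T ≃o T)) (g : G) (s : S) (t : T) :
    lexAction φ ρ u g (toLex (s, t)) = toLex (φ g s, (u (φ g s)).symm (ρ g (u s t))) := rfl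

/-- Conjugating an action by an order isomorphism. -/
def conjAction {G S T : Type*} [Group G] [LinearOrder S] [LinearOrder T] (φ : G →* (S ≃o S))
    (e : S ≃o T) : G →* (T ≃o T) where
  toFun g := (e.symm.trans (φ g)).trans e
  map_one' := by ext t; simp
  map_mul' g h := by ext t; simp

lemma conjAction_apply {G S T : Type*} [Group G] [LinearOrder S] [LinearOrder T]
    (φ : G →* (S ≃o S)) (e : S ≃o T) (g : G) (s : S) :
    conjAction φ e g (e s) = e (φ g s) := by
  simp [conjAction]

/-- The action on the orbit of a point. -/
def orbitAction {G S : Type*} [Group G] [LinearOrder S] (φ : G →* (S ≃o S)) (s : S) :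
    G →* (Set.range (fun g => φ g s) ≃o Set.range (fun g => φ g s)) where
  toFun g := StrictMono.orderIsoOfRightInverse
    (fun p => ⟨φ g p, by
      obtain ⟨h, hh⟩ := p.2
      exact ⟨g * h, by rw [← hh]; simp⟩⟩)
    (fun p q h => (φ g).lt_iff_lt.2 h)
    (fun p => ⟨φ g⁻¹ p, by
      obtain ⟨h, hh⟩ := p.2
      exact ⟨g⁻¹ * h, by rw [← hh]; simp⟩⟩)
    (fun p => Subtype.ext (by
      have h1 : ∀ s, φ g ((φ g)⁻¹ s) = s := fun s => (φ g).apply_symm_apply s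
      simp [h1]))
  map_one' := by ext p; simp
  map_mul' g h := by
    ext p
    change φ (g * h) p = φ g (φ h p)
    simp

/-- An orbit of a countable group acting on a linearly ordered set is realised as an orbit of an
action on the real line. -/
lemma exists_real_action {G S : Type*} [Group G] [Countable G] [LinearOrder S]
    (φ : G →* (S ≃o S)) (s : S) :
    ∃ Φ : G →* (ℝ ≃o ℝ), ∀ g h, Φ g 0 = Φ h 0 ↔ φ g s = φ h s := by
  let Y := Set.range (fun g => φ g s)
  have : Countable Y := (Set.countable_range _).to_subtype
  let y₀ : Y := ⟨s, 1, by simp⟩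
  have : Countable (Y ×ₗ ℚ) := inferInstanceAs (Countable (Y × ℚ))
  have : Nonempty (Y ×ₗ ℚ) := ⟨toLex (y₀, 0)⟩
  obtain ⟨e⟩ := Order.iso_of_countable_dense (Y ×ₗ ℚ) ℚ
  let ψ : G →* (ℚ ≃o ℚ) := conjAction (lexAction (orbitAction φ s) 1 (fun _ => 1)) e
  let c : ℝ := (e (toLex (y₀, 0)) : ℝ)
  let Φ : G →* (ℝ ≃o ℝ) := conjAction (ratExtendHom.comp ψ) (OrderIso.subRight c)
  have key : ∀ g, Φ g 0 = (e (toLex (orbitAction φ s g y₀, 0)) : ℝ) - c := by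
    intro g
    have h0 : (0 : ℝ) = OrderIso.subRight c c := by simp
    rw [h0, conjAction_apply, MonoidHom.comp_apply, ratExtendHom_ratCast, conjAction_apply,
      lexAction_apply]
    have h1 : (OrderIso.symm (1 : ℚ ≃o ℚ)) 0 = 0 := rfl
    simp [h1]
  refine ⟨Φ, fun g h => ?_⟩
  rw [key, key, sub_left_inj, Rat.cast_inj, e.injective.eq_iff, toLex_inj]
  simp only [Prod.mk.injEq, and_true, Subtype.ext_iff]
  rfl

/-- A group acting on the line gives an action by odd homeomorphisms, fixing `0`, whose
restriction to the positive half line is conjugate to the original one. -/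
noncomputable def oddAction {G : Type*} [Group G] (φ : G →* (ℝ ≃o ℝ)) : G →* (ℝ ≃o ℝ) :=
  have hlog : ∀ (g : G) (t : ℝ), t ≠ 0 →
      Real.log (SignType.sign t * Real.exp (φ g (Real.log t))) = φ g (Real.log t) := by
    intro g t ht
    rcases lt_or_gt_of_ne ht with h | h <;> simp [h]
  have hsign : ∀ (g : G) (t : ℝ),
      SignType.sign (SignType.sign t * Real.exp (φ g (Real.log t)) : ℝ) = SignType.sign t := by
    intro g t
    rcases lt_trichotomy t 0 with h | h | h
    · simp [h, Real.exp_pos]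
    · simp [h]
    · simp [h, Real.exp_pos]
  have hinv : ∀ (g h : G) (t : ℝ), (SignType.sign t * Real.exp (φ (g * h) (Real.log t)) : ℝ) =
      SignType.sign (SignType.sign t * Real.exp (φ h (Real.log t)) : ℝ) *
        Real.exp (φ g (Real.log (SignType.sign t * Real.exp (φ h (Real.log t))))) := by
    intro g h t
    rw [hsign]
    rcases eq_or_ne t 0 with rfl | ht
    · simp
    · rw [hlog h t ht]; simp
  have hone : ∀ t : ℝ, (SignType.sign t * Real.exp (φ 1 (Real.log t)) : ℝ) = t := by
    intro t
    rcases lt_trichotomy t 0 with h | h | h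
    · simp [h, Real.exp_log_of_neg h]
    · simp [h]
    · simp [h, Real.exp_log h]
  { toFun := fun g => StrictMono.orderIsoOfRightInverse
      (fun t => SignType.sign t * Real.exp (φ g (Real.log t)))
      (by
        intro s t h
        rcases lt_trichotomy s 0 with hs | rfl | hs
        · rcases lt_trichotomy t 0 with ht | rfl | ht
          · have : Real.log t < Real.log s := by
              rw [← Real.log_neg_eq_log t, ← Real.log_neg_eq_log s]
              exact Real.log_lt_log (by linarith) (by linarith)
            simpa [hs, ht] using this
          · simp [hs, Real.exp_pos]
          · have h1 := Real.exp_pos (φ g (Real.log s))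
            have h2 := Real.exp_pos (φ g (Real.log t))
            simp [hs, ht]
            linarith
        · simp [h, Real.exp_pos]
        · have := Real.log_lt_log hs h
          simpa [hs, hs.trans h] using this)
      (fun t => SignType.sign t * Real.exp (φ g⁻¹ (Real.log t)))
      (by
        intro t
        have := hinv g g⁻¹ t
        rw [mul_inv_cancel, hone] at this
        exact this.symm)
    map_one' := by ext t; exact hone t
    map_mul' := fun g h => by ext t; exact hinv g h t }

lemma oddAction_apply {G : Type*} [Group G] (φ : G →* (ℝ ≃o ℝ)) (g : G) (t : ℝ) :
    oddAction φ g t = SignType.sign t * Real.exp (φ g (Real.log t)) := rfl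

lemma oddAction_neg {G : Type*} [Group G] (φ : G →* (ℝ ≃o ℝ)) (g : G) (t : ℝ) :
    oddAction φ g (-t) = -oddAction φ g t := by
  simp [oddAction_apply, Left.sign_neg]

/-- A countable right-orderable group acts on the line by odd homeomorphisms such that the point
`1` has trivial stabiliser. -/
lemma exists_odd_action {A : Type*} [Group A] [Countable A] (hA : IsRightOrderable A) :
    ∃ ρ : A →* (ℝ ≃o ℝ), (∀ g t, ρ g (-t) = -ρ g t) ∧ ∀ g, ρ g 1 = 1 → g = 1 := by
  classical
  obtain ⟨lt, hlt, hmul⟩ := hA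
  let _ : LinearOrder A := linearOrderOfSTO lt
  let φ : A →* (A ≃o A) :=
    { toFun := fun g => StrictMono.orderIsoOfRightInverse (fun x => x * g⁻¹)
        (fun x y h => hmul x y g⁻¹ h) (fun x => x * g) (fun x => by simp)
      map_one' := by ext x; simp
      map_mul' := fun g h => by
        ext x
        change x * (g * h)⁻¹ = x * h⁻¹ * g⁻¹
        simp [mul_assoc] }
  obtain ⟨Φ, hΦ⟩ := exists_real_action φ 1
  refine ⟨oddAction Φ, oddAction_neg Φ, fun g hg => ?_⟩
  have h1 : Φ g 0 = Φ 1 0 := by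
    simpa [oddAction_apply] using hg
  have h2 := (hΦ g 1).1 h1
  change (1 : A) * g⁻¹ = 1 * 1⁻¹ at h2
  simpa using h2

/-- `TurnPath src tgt a s g s'` says that some path along the edges `src i → tgt i`, labelled by
`a i` and traversed in either direction, leads from `s` to `s'` and has total label `g`. -/
inductive TurnPath {A X I : Type*} [Group A] (src tgt : I → X) (a : I → A) : X → A → X → Prop
  | refl (s : X) : TurnPath src tgt a s 1 s
  | forward {s : X} {g : A} {i : I} (h : TurnPath src tgt a s g (src i)) :
      TurnPath src tgt a s (a i * g) (tgt i)
  | backward {s : X} {g : A} {i : I} (h : TurnPath src tgt a s g (tgt i)) :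
      TurnPath src tgt a s ((a i)⁻¹ * g) (src i)

namespace TurnPath

variable {A X I : Type*} [Group A] {src tgt : I → X} {a : I → A}

lemma trans {s s' s'' : X} {g h : A} (h₁ : TurnPath src tgt a s g s')
    (h₂ : TurnPath src tgt a s' h s'') : TurnPath src tgt a s (h * g) s'' := by
  induction h₂ with
  | refl => simpa using h₁
  | forward _ ih => rw [mul_assoc]; exact ih.forward
  | backward _ ih => rw [mul_assoc]; exact ih.backward

lemma edge (i : I) : TurnPath src tgt a (src i) (a i) (tgt i) := by
  simpa using (refl (src := src) (tgt := tgt) (a := a) (src i)).forward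

lemma edge_inv (i : I) : TurnPath src tgt a (tgt i) (a i)⁻¹ (src i) := by
  simpa using (refl (src := src) (tgt := tgt) (a := a) (tgt i)).backward

lemma symm {s s' : X} {g : A} (h : TurnPath src tgt a s g s') :
    TurnPath src tgt a s' g⁻¹ s := by
  induction h with
  | refl => simpa using refl s
  | forward _ ih => rw [mul_inv_rev]; exact (edge_inv _).trans ih
  | backward _ ih => rw [mul_inv_rev, inv_inv]; exact (edge _).trans ih

lemma map_apply {T : Type*} [LE T] {ρ : A →* (T ≃o T)} {q : X → T}
    (hq : ∀ i, q (tgt i) = ρ (a i) (q (src i))) {s s' : X} {g : A}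
    (h : TurnPath src tgt a s g s') : q s' = ρ g (q s) := by
  induction h with
  | refl => simp
  | forward _ ih => rw [hq, ih]; simp
  | @backward g i _ ih =>
    rw [map_mul, RelIso.mul_apply, ← ih, hq, ← RelIso.mul_apply, ← map_mul]
    simp

variable (src tgt a) in
/-- Two points are equivalent if a path leads from one to the other. -/
def setoid : Setoid X where
  r s s' := ∃ g, TurnPath src tgt a s g s'
  iseqv := ⟨fun s => ⟨1, refl s⟩, fun ⟨g, h⟩ => ⟨g⁻¹, h.symm⟩,
    fun ⟨g, h⟩ ⟨k, h'⟩ => ⟨k * g, h.trans h'⟩⟩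

end TurnPath

/-- At most half as many classes as there are points have trivial loop labels, and in the extremal
case the classes are pairs and every edge is determined by each of its endpoints. -/
lemma exists_turn_classes {A X I : Type*} [Group A] [Finite X] (src tgt : I → X) (a : I → A)
    (ha : ∀ i, a i ≠ 1) (hX : ∀ x, ∃ i, x = src i ∨ x = tgt i) :
    ∃ (r : Setoid X) (κ : X → A) (good : Quotient r → Prop),
      (∀ i, r (src i) (tgt i)) ∧
      (∀ (ρ : A →* (ℝ ≃o ℝ)) (p : X → ℝ),
        (∀ i, p (tgt i) = ρ ((κ (tgt i))⁻¹ * a i * κ (src i)) (p (src i))) →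
        (∀ x x', r x x' → p x = p x') ∧
        ∀ x, ¬ good (Quotient.mk r x) → ∃ g, g ≠ 1 ∧ ρ g (p x) = p x) ∧
      2 * Nat.card {c // good c} ≤ Nat.card X ∧
      (2 * Nat.card {c // good c} = Nat.card X → ∀ i j,
        (src i = src j → tgt i = tgt j ∧ a i = a j) ∧
        (tgt i = tgt j → src i = src j ∧ a i = a j) ∧
        (src i = tgt j → tgt i = src j) ∧ src i ≠ tgt i) := by
  classical
  have := Fintype.ofFinite X
  let r := TurnPath.setoid src tgt a
  have hout : ∀ x, ∃ g, TurnPath src tgt a (Quotient.mk r x).out g x := fun x =>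
    Quotient.exact (Quotient.out_eq (Quotient.mk r x))
  choose κ hκ using hout
  let good : Quotient r → Prop := fun c => ∀ g, TurnPath src tgt a c.out g c.out → g = 1
  have hgood : ∀ x, good (Quotient.mk r x) → ∀ g, TurnPath src tgt a x g x → g = 1 := by
    intro x hx g hg
    have := hx _ (((hκ x).trans hg).trans (hκ x).symm)
    rw [inv_mul_eq_one] at this
    simpa using this.symm
  have hedge : ∀ i, Quotient.mk r (src i) = Quotient.mk r (tgt i) := fun i =>
    Quotient.sound ⟨_, TurnPath.edge i⟩
  have hne : ∀ i, good (Quotient.mk r (src i)) → src i ≠ tgt i := by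
    intro i hi h
    refine ha i (hgood _ hi _ ?_)
    have := TurnPath.edge (src := src) (tgt := tgt) (a := a) i
    rwa [← h] at this
  let fib : Quotient r → Finset X := fun c => Finset.univ.filter fun x => Quotient.mk r x = c
  have hsum : ∑ c, (fib c).card = Fintype.card X := by
    rw [← Finset.card_univ]
    exact (Finset.card_eq_sum_card_fiberwise (f := Quotient.mk r) (t := Finset.univ)
      (fun x _ => Finset.mem_coe.2 (Finset.mem_univ _))).symm
  have hcount : ∑ c : Quotient r, (if good c then 2 else 0) = 2 * Nat.card {c // good c} := by
    rw [← Finset.sum_filter, Finset.sum_const, Nat.card_eq_fintype_card, Fintype.card_subtype,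
      smul_eq_mul, mul_comm]
  have hpos : ∀ c, 0 < (fib c).card := by
    intro c
    refine Finset.card_pos.2 ⟨c.out, ?_⟩
    simp [fib]
  have hle : ∀ c ∈ (Finset.univ : Finset (Quotient r)),
      (if good c then 2 else 0) ≤ (fib c).card := by
    intro c _
    split_ifs with hc
    · induction c using Quotient.inductionOn with | _ x => ?_
      obtain ⟨i, hi⟩ := hX x
      have hx : Quotient.mk r x = Quotient.mk r (src i) := by
        rcases hi with rfl | rfl
        · rfl
        · exact (hedge i).symm
      have : ({src i, tgt i} : Finset X) ⊆ fib (Quotient.mk r x) := by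
        intro y hy
        simp only [Finset.mem_insert, Finset.mem_singleton] at hy
        rcases hy with rfl | rfl
        · simp [fib, hx]
        · simp [fib, hx, hedge]
      refine le_trans ?_ (Finset.card_le_card this)
      rw [Finset.card_pair (hne i (hx ▸ hc))]
    · exact Nat.zero_le _
  refine ⟨r, κ, good, fun i => ⟨_, TurnPath.edge i⟩, ?_, ?_, ?_⟩
  · intro ρ p hp
    have hq : ∀ i, (fun x => ρ (κ x) (p x)) (tgt i) =
        ρ (a i) ((fun x => ρ (κ x) (p x)) (src i)) := by
      intro i
      simp only [hp i, ← RelIso.mul_apply, ← map_mul]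
      congr 2
      group
    have hpx : ∀ x, p x = ρ (κ (Quotient.mk r x).out) (p (Quotient.mk r x).out) := by
      intro x
      exact (ρ (κ x)).injective
        ((hκ x).map_apply (q := fun x => ρ (κ x) (p x)) (ρ := ρ) hq)
    refine ⟨fun x x' h => ?_, fun x hx => ?_⟩
    · rw [hpx x, hpx x', Quotient.sound h]
    · simp only [good, not_forall] at hx
      obtain ⟨g, hg, hg1⟩ := hx
      refine ⟨g, hg1, ?_⟩
      rw [hpx x]
      exact (hg.map_apply (q := fun x => ρ (κ x) (p x)) (ρ := ρ) hq).symm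
  · rw [← hcount, Nat.card_eq_fintype_card, ← hsum]
    exact Finset.sum_le_sum hle
  · intro heq
    rw [← hcount, Nat.card_eq_fintype_card, ← hsum, Finset.sum_eq_sum_iff_of_le hle] at heq
    have hall : ∀ c, good c ∧ (fib c).card = 2 := by
      intro c
      have h1 := heq c (Finset.mem_univ _)
      have h2 := hpos c
      split_ifs at h1 with hc
      · exact ⟨hc, h1.symm⟩
      · omega
    have htwo : ∀ x y z, Quotient.mk r x = Quotient.mk r y → Quotient.mk r x = Quotient.mk r z →
        x ≠ y → x ≠ z → y = z := by
      intro x y z hxy hxz hy hz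
      by_contra hyz
      have : 2 < (fib (Quotient.mk r x)).card :=
        Finset.two_lt_card_iff.2 ⟨x, y, z, by simp [fib], by simp [fib, hxy], by simp [fib, hxz],
          hy, hz, hyz⟩
      have := (hall (Quotient.mk r x)).2
      omega
    have hne' := fun i => hne i (hall _).1
    have hlabel : ∀ i j, src i = src j → tgt i = tgt j → a i = a j := by
      intro i j hs ht
      have h1 := TurnPath.edge (src := src) (tgt := tgt) (a := a) i
      have h2 := TurnPath.edge_inv (src := src) (tgt := tgt) (a := a) j
      rw [← hs, ← ht] at h2
      have := hgood _ (hall _).1 _ (h1.trans h2)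
      rw [inv_mul_eq_one] at this
      exact this.symm
    intro i j
    refine ⟨fun h => ?_, fun h => ?_, fun h => ?_, hne' i⟩
    · have ht : tgt i = tgt j :=
        htwo (src i) _ _ (hedge i) (by rw [h, hedge]) (hne' i) (by rw [h]; exact hne' j)
      exact ⟨ht, hlabel i j h ht⟩
    · have hs : src i = src j :=
        htwo (tgt i) _ _ (hedge i).symm (by rw [h, hedge]) (hne' i).symm
          (by rw [h]; exact (hne' j).symm)
      exact ⟨hs, hlabel i j hs h⟩
    · exact htwo (src i) _ _ (hedge i) (by rw [h, hedge]) (hne' i)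
        (by rw [h]; exact (hne' j).symm)

/-- An odd continuous function of two real parameters vanishes somewhere on the unit square. -/
lemma exists_zero_on_square_of_odd {E : Type*} [AddCommGroup E] [Module ℝ E] [TopologicalSpace E]
    [ContinuousAdd E] [ContinuousSMul ℝ E] {f : E → ℝ} (hf : Continuous f)
    (hodd : ∀ x, f (-x) = -f x) (e₁ e₂ : E) :
    ∃ θ₁ θ₂ : ℝ, (|θ₁| = 1 ∨ |θ₂| = 1) ∧ f (θ₁ • e₁ + θ₂ • e₂) = 0 := by
  have hrank : 1 < Module.rank ℝ (ℝ × ℝ) := Module.lt_rank_of_lt_finrank (by simp)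
  have hconn := isPreconnected_sphere hrank (0 : ℝ × ℝ) 1
  let F : ℝ × ℝ → ℝ := fun θ => f (θ.1 • e₁ + θ.2 • e₂)
  have hF : Continuous F := by fun_prop
  have hFneg : ∀ θ, F (-θ) = -F θ := by
    intro θ
    simp only [F, ← hodd]
    congr 1
    simp only [Prod.fst_neg, Prod.snd_neg, neg_smul, neg_add_rev]
    abel
  have h₁ : ((1, 0) : ℝ × ℝ) ∈ Metric.sphere (0 : ℝ × ℝ) 1 := by simp [Prod.norm_def]
  have h₂ : -((1, 0) : ℝ × ℝ) ∈ Metric.sphere (0 : ℝ × ℝ) 1 := by simp [Prod.norm_def]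
  have h0 : ∃ θ ∈ Metric.sphere (0 : ℝ × ℝ) 1, F θ = 0 := by
    rcases le_total (F (1, 0)) 0 with h | h
    · exact hconn.intermediate_value h₁ h₂ hF.continuousOn ⟨h, by rw [hFneg]; linarith⟩
    · exact hconn.intermediate_value h₂ h₁ hF.continuousOn ⟨by rw [hFneg]; linarith, h⟩
  obtain ⟨θ, hθ, hθ0⟩ := h0
  refine ⟨θ.1, θ.2, ?_, hθ0⟩
  rw [mem_sphere_zero_iff_norm, Prod.norm_def, Real.norm_eq_abs, Real.norm_eq_abs] at hθ
  rcases max_choice |θ.1| |θ.2| with h | h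
  · exact Or.inl (h ▸ hθ)
  · exact Or.inr (h ▸ hθ)

/-- If few of the coordinates of an injective linear map are good, there is a plane whose unit
square meets the image only in vectors having a bad coordinate equal to `1` or `-1`. -/
lemma exists_plane_avoiding {E C : Type*} [AddCommGroup E] [Module ℝ E] [FiniteDimensional ℝ E]
    [Finite C] (Θ : (C → ℝ) →ₗ[ℝ] E) (hΘ : Function.Injective Θ) (good : C → Prop)
    (hcard : Nat.card {c // good c} + 2 ≤ Module.finrank ℝ E) :
    ∃ e₁ e₂ : E, ∀ (θ₁ θ₂ : ℝ) (p : C → ℝ), Θ p = θ₁ • e₁ + θ₂ • e₂ →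
      (∀ c, ¬ good c → |p c| ≠ 1) → |θ₁| ≠ 1 ∧ |θ₂| ≠ 1 := by
  classical
  have := Fintype.ofFinite C
  let v : C → E := fun c => Θ (Pi.single c 1)
  have hv : LinearIndependent ℝ v := by
    have h1 : LinearIndependent ℝ (fun c : C => (Pi.single c 1 : C → ℝ)) := by
      have := (Pi.basisFun ℝ C).linearIndependent
      convert this using 1
      ext c
      simp
    exact h1.map' Θ (LinearMap.ker_eq_bot.2 hΘ)
  have hsub := Module.Basis.subset_extend hv.linearIndepOn_id
  let b := Module.Basis.extend hv.linearIndepOn_id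
  have hb : ∀ x, b x = (x : E) := Module.Basis.extend_apply_self _
  have hfin := Module.Finite.finite_basis b
  let w : C → _ := fun c => (⟨v c, hsub ⟨c, rfl⟩⟩ : hv.linearIndepOn_id.extend (Set.subset_univ _))
  have := Fintype.ofFinite (hv.linearIndepOn_id.extend (Set.subset_univ (Set.range v)))
  have hw : Function.Injective w := fun c d h => hv.injective (congrArg Subtype.val h)
  have hΘsum : ∀ p, Θ p = ∑ c, p c • b (w c) := by
    intro p
    conv_lhs => rw [pi_eq_sum_univ' p]
    rw [map_sum]
    refine Finset.sum_congr rfl fun c _ => ?_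
    rw [map_smul, hb]
  have hcoord : ∀ p d, (∀ c, d = w c → ¬ good c) → (∀ c, ¬ good c → |p c| ≠ 1) →
      |b.repr (Θ p) d| ≠ 1 := by
    intro p d hd hp
    rw [hΘsum, map_sum, Finsupp.finsetSum_apply]
    simp only [map_smul, Module.Basis.repr_self, Finsupp.smul_apply, Finsupp.single_apply,
      smul_eq_mul, mul_ite, mul_one, mul_zero]
    by_cases h : ∃ c, d = w c
    · obtain ⟨c, rfl⟩ := h
      simp only [hw.eq_iff, Finset.sum_ite_eq', Finset.mem_univ, if_true]
      exact hp c (hd c rfl)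
    · rw [Finset.sum_eq_zero]
      · simp
      · intro c _
        rw [if_neg fun h' => h ⟨c, h'.symm⟩]
  obtain ⟨d₁, hd₁, d₂, hd₂, hne⟩ : ∃ d₁, (∀ c, d₁ = w c → ¬ good c) ∧
      ∃ d₂, (∀ c, d₂ = w c → ¬ good c) ∧ d₁ ≠ d₂ := by
    have h1 : ((Finset.univ.filter good).image w).card + 2 ≤
        Fintype.card (hv.linearIndepOn_id.extend (Set.subset_univ (Set.range v))) := by
      rw [← Module.finrank_eq_card_basis b]
      refine le_trans (Nat.add_le_add_right Finset.card_image_le 2) ?_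
      rwa [Nat.card_eq_fintype_card, Fintype.card_subtype] at hcard
    have h2 : 1 < ((Finset.univ.filter good).image w)ᶜ.card := by
      rw [Finset.card_compl]
      exact Nat.lt_sub_of_add_lt (lt_of_lt_of_le (by omega) h1)
    obtain ⟨d₁, h₁, d₂, h₂, hne⟩ := Finset.one_lt_card.1 h2
    have key : ∀ d, d ∈ ((Finset.univ.filter good).image w)ᶜ → ∀ c, d = w c → ¬ good c := by
      rintro _ hd c rfl hc
      simp only [Finset.mem_compl, Finset.mem_image, Finset.mem_filter, Finset.mem_univ,
        true_and, not_exists, not_and] at hd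
      exact hd c hc rfl
    exact ⟨d₁, key _ h₁, d₂, key _ h₂, hne⟩
  refine ⟨b d₁, b d₂, fun θ₁ θ₂ p hp hbad => ?_⟩
  have h₁ := hcoord p d₁ hd₁ hbad
  have h₂ := hcoord p d₂ hd₂ hbad
  rw [hp] at h₁ h₂
  simp only [map_add, map_smul, Module.Basis.repr_self, Finsupp.add_apply, Finsupp.smul_apply,
    smul_eq_mul, Finsupp.single_eq_same, Finsupp.single_eq_of_ne hne,
    Finsupp.single_eq_of_ne hne.symm,
    mul_one, mul_zero, add_zero, zero_add] at h₁ h₂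
  exact ⟨h₁, h₂⟩

lemma abs_ne_one_of_fixed {G : Type*} [Group G] {ρ : G →* (ℝ ≃o ℝ)}
    (hodd : ∀ g t, ρ g (-t) = -ρ g t) (hfree : ∀ g, ρ g 1 = 1 → g = 1) {s : ℝ}
    (h : ∃ g, g ≠ 1 ∧ ρ g s = s) : |s| ≠ 1 := by
  obtain ⟨g, hg, hs⟩ := h
  intro habs
  rcases eq_or_eq_neg_of_abs_eq habs with rfl | rfl
  · exact hg (hfree g hs)
  · rw [hodd, neg_inj] at hs
    exact hg (hfree g hs)

/-- Lifting a closed path to a path of real numbers that does not factor through its vertices. -/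
lemma exists_lift_not_factoring {A B X : Type*} [Group A] [Group B] [Finite X]
    {n : ℕ} {y z : ℕ → X} {a : ℕ → A} {b : ℕ → B}
    (hX : ∀ x, ∃ i, x = y i ∨ x = z i) (hy : ∀ i, y (i + n) = y i) (hz : ∀ i, z (i + n) = z i)
    (ha : ∀ i, a (i + n) = a i) (hb : ∀ i, b (i + n) = b i)
    {ρA : A →* (ℝ ≃o ℝ)} (hAodd : ∀ g t, ρA g (-t) = -ρA g t) (hA1 : ∀ g, ρA g 1 = 1 → g = 1)
    {ρB : B →* (ℝ ≃o ℝ)} (hBodd : ∀ g t, ρB g (-t) = -ρB g t) (hB1 : ∀ g, ρB g 1 = 1 → g = 1)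
    (rA : Setoid X) (κA : X → A) (goodA : Quotient rA → Prop)
    (rB : Setoid X) (κB : X → B) (goodB : Quotient rB → Prop)
    (hA : ∀ p : X → ℝ, (∀ i, p (z i) = ρA ((κA (z i))⁻¹ * a i * κA (y i)) (p (y i))) →
      (∀ x x', rA x x' → p x = p x') ∧
        ∀ x, ¬ goodA (Quotient.mk rA x) → ∃ g, g ≠ 1 ∧ ρA g (p x) = p x)
    (hB : ∀ p : X → ℝ, (∀ i, p (y (i + 1)) =
        ρB ((κB (y (i + 1)))⁻¹ * b i * κB (z i)) (p (z i))) →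
      (∀ x x', rB x x' → p x = p x') ∧
        ∀ x, ¬ goodB (Quotient.mk rB x) → ∃ g, g ≠ 1 ∧ ρB g (p x) = p x)
    (hAr : ∀ i, rA (y i) (z i)) (hBr : ∀ i, rB (z i) (y (i + 1)))
    (hcard : Nat.card {c // goodA c} + Nat.card {c // goodB c} + 1 ≤ Nat.card X) :
    ∃ (l : X → ℝ) (ty tz : ℕ → ℝ),
      (∀ i, tz i + l (z i) = ρA ((κA (z i))⁻¹ * a i * κA (y i)) (ty i + l (y i))) ∧
      (∀ i, ty (i + 1) = ρB ((κB (y (i + 1)))⁻¹ * b i * κB (z i)) (tz i)) ∧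
      (∀ i, ty (i + n) = ty i) ∧
      ¬ ∃ t : X → ℝ, (∀ i, ty i = t (y i)) ∧ ∀ i, tz i = t (z i) := by
  classical
  have := Fintype.ofFinite X
  let Θ : (Quotient rA ⊕ Quotient rB → ℝ) →ₗ[ℝ] ℝ × (X → ℝ) :=
    { toFun := fun p => (p (Sum.inr (Quotient.mk rB (y 0))),
        fun x => p (Sum.inl (Quotient.mk rA x)) - p (Sum.inr (Quotient.mk rB x)))
      map_add' := by
        intro p q
        ext <;> simp
        ring
      map_smul' := by
        intro c p
        ext <;> simp
        ring }
  have hΘ : Function.Injective Θ := by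
    rw [injective_iff_map_eq_zero]
    intro p hp
    obtain ⟨hp0, hp1⟩ := Prod.ext_iff.1 hp
    replace hp0 : p (Sum.inr (Quotient.mk rB (y 0))) = 0 := hp0
    replace hp1 : ∀ x, p (Sum.inl (Quotient.mk rA x)) = p (Sum.inr (Quotient.mk rB x)) :=
      fun x => sub_eq_zero.1 (congrFun hp1 x)
    have hstep : ∀ i, p (Sum.inr (Quotient.mk rB (y i))) = 0 ∧
        p (Sum.inr (Quotient.mk rB (z i))) = 0 := by
      intro i
      have hyz : ∀ i, p (Sum.inr (Quotient.mk rB (z i))) = p (Sum.inr (Quotient.mk rB (y i))) := by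
        intro i
        rw [← hp1, ← hp1, Quotient.sound (hAr i)]
      rw [hyz, and_self]
      induction i with
      | zero => exact hp0
      | succ i ih => rw [← Quotient.sound (hBr i), hyz, ih]
    have hall : ∀ x, p (Sum.inr (Quotient.mk rB x)) = 0 := by
      intro x
      obtain ⟨i, rfl | rfl⟩ := hX x
      exacts [(hstep i).1, (hstep i).2]
    ext (c | c)
    · induction c using Quotient.inductionOn with
      | h x => rw [hp1, hall]; rfl
    · induction c using Quotient.inductionOn with
      | h x => rw [hall]; rfl
  obtain ⟨e₁, e₂, hplane⟩ := exists_plane_avoiding Θ hΘ (Sum.elim goodA goodB) (by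
    have h1 : Nat.card {c // Sum.elim goodA goodB c} =
        Nat.card {c // goodA c} + Nat.card {c // goodB c} := by
      rw [Nat.card_congr (Equiv.subtypeSum), Nat.card_sum]
      rfl
    rw [h1, Module.finrank_prod, Module.finrank_self, Module.finrank_pi,
      ← Nat.card_eq_fintype_card]
    omega)
  let sz : ℝ × (X → ℝ) → ℕ → ℝ → ℝ := fun e i t =>
    ρA ((κA (z i))⁻¹ * a i * κA (y i)) (t + e.2 (y i)) - e.2 (z i)
  let ty : ℝ × (X → ℝ) → ℕ → ℝ := fun e i => Nat.rec e.1
    (fun i t => ρB ((κB (y (i + 1)))⁻¹ * b i * κB (z i)) (sz e i t)) i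
  have hty : ∀ e i, ty e (i + 1) =
    ρB ((κB (y (i + 1)))⁻¹ * b i * κB (z i)) (sz e i (ty e i)) := fun e i => rfl
  have hcont : ∀ i, Continuous fun e => ty e i := by
    intro i
    induction i with
    | zero => exact continuous_fst
    | succ i ih =>
      simp only [hty, sz]
      have := (ρA ((κA (z i))⁻¹ * a i * κA (y i))).continuous
      have := (ρB ((κB (y (i + 1)))⁻¹ * b i * κB (z i))).continuous
      fun_prop
  have hodd : ∀ i e, ty (-e) i = -ty e i := by
    intro i e
    induction i with
    | zero => rfl
    | succ i ih =>
      rw [hty, hty, ih, ← hBodd]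
      congr 1
      simp only [sz, Prod.snd_neg, Pi.neg_apply]
      rw [← neg_add, hAodd]
      ring
  obtain ⟨θ₁, θ₂, hθ, hzero⟩ := exists_zero_on_square_of_odd (f := fun e => ty e n - e.1)
    ((hcont n).sub continuous_fst) (fun e => by rw [hodd, Prod.fst_neg]; ring) e₁ e₂
  set e := θ₁ • e₁ + θ₂ • e₂ with he
  refine ⟨e.2, ty e, fun i => sz e i (ty e i), fun i => by simp [sz], hty e, ?_, ?_⟩
  · intro i
    induction i with
    | zero => rw [zero_add]; exact sub_eq_zero.1 hzero
    | succ i ih =>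
      have hy' : y (i + n + 1) = y (i + 1) := by rw [add_right_comm, hy]
      rw [add_right_comm, hty, hty, ih, hy', hb, hz]
      simp only [sz, hy, hz, ha]
  · rintro ⟨t, ht, ht'⟩
    obtain ⟨hA2, hA3⟩ := hA (fun x => t x + e.2 x) (fun i => by
      simp only [← ht, ← ht', sz, sub_add_cancel])
    obtain ⟨hB2, hB3⟩ := hB t (fun i => by rw [← ht, ← ht', hty])
    have := hplane θ₁ θ₂ (Sum.elim (Quotient.lift _ hA2) (Quotient.lift _ hB2))
      (by
        rw [← he]
        refine Prod.ext ?_ ?_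
        · exact (ht 0).symm
        · ext x
          exact add_sub_cancel_left _ _)
      (by
        rintro (c | c)
        · induction c using Quotient.inductionOn with
          | h x => exact fun h => abs_ne_one_of_fixed hAodd hA1 (hA3 x h)
        · induction c using Quotient.inductionOn with
          | h x => exact fun h => abs_ne_one_of_fixed hBodd hB1 (hB3 x h))
    rcases hθ with h | h
    exacts [this.1 h, this.2 h]

/-- `y` and `z` are the even and odd vertices of the closed path read off from the periodic word
with letters `a 0, b 0, a 1, b 1, …`. -/
structure IsClosedTrack {A B S : Type*} [Group A] [Group B] [LinearOrder S] (n : ℕ)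
    (a : ℕ → A) (b : ℕ → B) (φA : A →* (S ≃o S)) (φB : B →* (S ≃o S)) (y z : ℕ → S) : Prop where
  left_step (i : ℕ) : z i = φA (a i) (y i)
  right_step (i : ℕ) : y (i + 1) = φB (b i) (z i)
  periodic (i : ℕ) : y (i + n) = y i

/-- Every edge of the path with the given edge labels is determined by each of its endpoints. -/
def IsMatching {A X : Type*} (src tgt : ℕ → X) (a : ℕ → A) : Prop :=
  ∀ i j, (src i = src j → tgt i = tgt j ∧ a i = a j) ∧ (tgt i = tgt j → src i = src j ∧ a i = a j) ∧
    (src i = tgt j → tgt i = src j) ∧ src i ≠ tgt i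

lemma IsMatching.map {A X Y : Type*} {src tgt : ℕ → X} {a : ℕ → A} (h : IsMatching src tgt a)
    {f : X → Y} (hf : Function.Injective f) :
    IsMatching (fun i => f (src i)) (fun i => f (tgt i)) a := by
  intro i j
  simpa only [hf.eq_iff, ne_eq] using h i j

/-- A closed track whose edges do not form matchings can be lifted to one with more vertices. -/
lemma IsClosedTrack.exists_lift {A B : Type*} [Group A] [Group B] [Countable A] [Countable B]
    (hA : IsRightOrderable A) (hB : IsRightOrderable B) {n : ℕ} (hn : 1 ≤ n)
    {a : ℕ → A} {b : ℕ → B}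
    (ha : ∀ i, a i ≠ 1) (hb : ∀ i, b i ≠ 1) (hap : ∀ i, a (i + n) = a i)
    (hbp : ∀ i, b (i + n) = b i)
    {S : Type} [LinearOrder S] {φA : A →* (S ≃o S)} {φB : B →* (S ≃o S)} {y z : ℕ → S}
    (h : IsClosedTrack n a b φA φB y z) (hfin : (Set.range y ∪ Set.range z).Finite)
    (hmatch : ¬ (IsMatching y z a ∧ IsMatching z (fun i => y (i + 1)) b)) :
    ∃ (φA' : A →* (S ×ₗ ℝ ≃o S ×ₗ ℝ)) (φB' : B →* (S ×ₗ ℝ ≃o S ×ₗ ℝ)) (y' z' : ℕ → S ×ₗ ℝ),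
      IsClosedTrack n a b φA' φB' y' z' ∧ (∀ i, (ofLex (y' i)).1 = y i) ∧
      (∀ i, (ofLex (z' i)).1 = z i) ∧
      ¬ ∃ t : S → ℝ, (∀ i, (ofLex (y' i)).2 = t (y i)) ∧ ∀ i, (ofLex (z' i)).2 = t (z i) := by
  classical
  have hzp : ∀ i, z (i + n) = z i := fun i => by
    rw [h.left_step, h.left_step, h.periodic, hap]
  let X := (Set.range y ∪ Set.range z : Set S)
  have : Finite X := hfin
  let y₁ : ℕ → X := fun i => ⟨y i, Or.inl ⟨i, rfl⟩⟩
  let z₁ : ℕ → X := fun i => ⟨z i, Or.inr ⟨i, rfl⟩⟩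
  have hX : ∀ x : X, ∃ i, x = y₁ i ∨ x = z₁ i := by
    rintro ⟨_, ⟨i, rfl⟩ | ⟨i, rfl⟩⟩
    exacts [⟨i, Or.inl rfl⟩, ⟨i, Or.inr rfl⟩]
  have hX' : ∀ x : X, ∃ i, x = z₁ i ∨ x = y₁ (i + 1) := by
    rintro ⟨_, ⟨i, rfl⟩ | ⟨i, rfl⟩⟩
    · refine ⟨i + n - 1, Or.inr ?_⟩
      rw [Nat.sub_add_cancel (by omega)]
      exact Subtype.ext (h.periodic i).symm
    · exact ⟨i, Or.inl rfl⟩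
  obtain ⟨rA, κA, goodA, hAr, hAf, hAc, hAm⟩ := exists_turn_classes y₁ z₁ a ha hX
  obtain ⟨rB, κB, goodB, hBr, hBf, hBc, hBm⟩ :=
    exists_turn_classes z₁ (fun i => y₁ (i + 1)) b hb hX'
  obtain ⟨ρA, hAodd, hA1⟩ := exists_odd_action hA
  obtain ⟨ρB, hBodd, hB1⟩ := exists_odd_action hB
  have hcard : Nat.card {c // goodA c} + Nat.card {c // goodB c} + 1 ≤ Nat.card X := by
    by_contra hcon
    exact hmatch ⟨IsMatching.map (hAm (by omega)) Subtype.val_injective,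
      IsMatching.map (hBm (by omega)) Subtype.val_injective⟩
  obtain ⟨l, ty, tz, h1, h2, h3, h4⟩ := exists_lift_not_factoring hX
    (fun i => Subtype.ext (h.periodic i)) (fun i => Subtype.ext (hzp i)) hap hbp hAodd hA1 hBodd hB1
    rA κA goodA rB κB goodB (hAf ρA) (hBf ρB) hAr hBr hcard
  let uA : S → (ℝ ≃o ℝ) := fun s => if hs : s ∈ X then
    (OrderIso.addRight (l ⟨s, hs⟩)).trans (ρA (κA ⟨s, hs⟩)) else OrderIso.refl ℝ
  let uB : S → (ℝ ≃o ℝ) := fun s => if hs : s ∈ X then ρB (κB ⟨s, hs⟩) else OrderIso.refl ℝ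
  have huA : ∀ x : X, uA x = (OrderIso.addRight (l x)).trans (ρA (κA x)) := fun x => dif_pos x.2
  have huB : ∀ x : X, uB x = ρB (κB x) := fun x => dif_pos x.2
  refine ⟨lexAction φA ρA uA, lexAction φB ρB uB, fun i => toLex (y i, ty i),
    fun i => toLex (z i, tz i), ⟨?_, ?_, ?_⟩, fun i => rfl, fun i => rfl, ?_⟩
  · intro i
    rw [lexAction_apply, ← h.left_step]
    congr 2
    rw [OrderIso.eq_symm_apply, huA (z₁ i), huA (y₁ i)]
    simp [h1, y₁, z₁]
  · intro i
    rw [lexAction_apply, ← h.right_step]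
    congr 2
    rw [OrderIso.eq_symm_apply, huB (z₁ i), huB (y₁ (i + 1))]
    simp [h2, y₁, z₁]
  · intro i
    simp only [h.periodic, h3]
  · rintro ⟨t, ht, ht'⟩
    exact h4 ⟨fun x => t x, ht, ht'⟩

lemma IsClosedTrack.vertices_subset {A B S : Type*} [Group A] [Group B] [LinearOrder S] {n : ℕ}
    (hn : 1 ≤ n) {a : ℕ → A} {b : ℕ → B} (hap : ∀ i, a (i + n) = a i)
    {φA : A →* (S ≃o S)} {φB : B →* (S ≃o S)} {y z : ℕ → S} (h : IsClosedTrack n a b φA φB y z) :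
    Set.range y ∪ Set.range z ⊆ ((y '' Set.Iio n) ∪ (z '' Set.Iio n) : Set S) := by
  have hzp : Function.Periodic z n := fun i => by
    rw [h.left_step, h.left_step, h.periodic, hap]
  have hyp : Function.Periodic y n := h.periodic
  have hmod : ∀ i, i % n ∈ Set.Iio n := fun i => Nat.mod_lt i hn
  rintro _ (⟨i, rfl⟩ | ⟨i, rfl⟩)
  · exact Or.inl ⟨i % n, hmod i, hyp.map_mod_nat i⟩
  · exact Or.inr ⟨i % n, hmod i, hzp.map_mod_nat i⟩

/-- There is a closed track whose edges form matchings. -/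
lemma exists_closedTrack_isMatching {A B : Type*} [Group A] [Group B] [Countable A] [Countable B]
    (hA : IsRightOrderable A) (hB : IsRightOrderable B) {n : ℕ} (hn : 1 ≤ n)
    {a : ℕ → A} {b : ℕ → B}
    (ha : ∀ i, a i ≠ 1) (hb : ∀ i, b i ≠ 1) (hap : ∀ i, a (i + n) = a i)
    (hbp : ∀ i, b (i + n) = b i) :
    ∃ (S : Type) (_ : LinearOrder S) (φA : A →* (S ≃o S)) (φB : B →* (S ≃o S)) (y z : ℕ → S),
      IsClosedTrack n a b φA φB y z ∧ IsMatching y z a ∧ IsMatching z (fun i => y (i + 1)) b := by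
  by_contra! hcon
  have hgrow : ∀ k : ℕ, ∃ (S : Type) (_ : LinearOrder S) (φA : A →* (S ≃o S))
      (φB : B →* (S ≃o S)) (y z : ℕ → S), IsClosedTrack n a b φA φB y z ∧
        k ≤ (Set.range y ∪ Set.range z).ncard := by
    intro k
    induction k with
    | zero =>
      exact ⟨Unit, inferInstance, 1, 1, fun _ => (), fun _ => (),
        ⟨fun _ => rfl, fun _ => rfl, fun _ => rfl⟩, Nat.zero_le _⟩
    | succ k ih =>
      obtain ⟨S, _, φA, φB, y, z, h, hk⟩ := ih
      have hfin := (((Set.finite_Iio n).image y).union ((Set.finite_Iio n).image z)).subset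
        (h.vertices_subset hn hap)
      obtain ⟨φA', φB', y', z', h', hy, hz, ht⟩ := h.exists_lift hA hB hn ha hb hap hbp hfin
        (fun hm => hcon S _ φA φB y z h hm.1 hm.2)
      have hfin' := (((Set.finite_Iio n).image y').union ((Set.finite_Iio n).image z')).subset
        (h'.vertices_subset hn hap)
      refine ⟨S ×ₗ ℝ, inferInstance, φA', φB', y', z', h', lt_of_le_of_lt hk ?_⟩
      have himage : (fun p : S ×ₗ ℝ => (ofLex p).1) '' (Set.range y' ∪ Set.range z') =
          Set.range y ∪ Set.range z := by
        rw [Set.image_union, ← Set.range_comp, ← Set.range_comp]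
        congr 2 <;> ext i <;> simp [hy, hz]
      rw [← himage]
      refine lt_of_le_of_ne (Set.ncard_image_le hfin') fun heq => ht ?_
      have hinj := (Set.ncard_image_iff hfin').1 heq
      classical
      let t : S → ℝ := fun s => if hs : ∃ p ∈ Set.range y' ∪ Set.range z', (ofLex p).1 = s then
        (ofLex hs.choose).2 else 0
      have ht : ∀ p ∈ Set.range y' ∪ Set.range z', (ofLex p).2 = t (ofLex p).1 := by
        intro p hp
        have hs : ∃ q ∈ Set.range y' ∪ Set.range z', (ofLex q).1 = (ofLex p).1 := ⟨p, hp, rfl⟩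
        simp only [t, dif_pos hs]
        rw [hinj hs.choose_spec.1 hp hs.choose_spec.2]
      refine ⟨t, fun i => ?_, fun i => ?_⟩
      · rw [ht _ (Or.inl ⟨i, rfl⟩), hy]
      · rw [ht _ (Or.inr ⟨i, rfl⟩), hz]
  obtain ⟨S, _, φA, φB, y, z, h, hk⟩ := hgrow (2 * n + 1)
  have hle : ∀ f : ℕ → S, (f '' Set.Iio n).ncard ≤ n := fun f => by
    refine (Set.ncard_image_le (Set.finite_Iio n)).trans ?_
    rw [← Finset.coe_range, Set.ncard_coe_finset, Finset.card_range]
  have h1 := Set.ncard_le_ncard (h.vertices_subset hn hap)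
    (((Set.finite_Iio n).image y).union ((Set.finite_Iio n).image z))
  have h2 := Set.ncard_union_le (y '' Set.Iio n) (z '' Set.Iio n)
  have := hle y
  have := hle z
  omega

lemma periodic_gcd {α : Type*} {f : ℕ → α} {d n : ℕ} (hn : 0 < n) (hd : Function.Periodic f d)
    (hf : Function.Periodic f n) : Function.Periodic f (d.gcd n) := by
  rcases (Nat.gcd_le_right d hn).lt_or_eq with h | h
  · obtain ⟨m, _, hm⟩ := Nat.exists_mul_mod_eq_gcd h
    intro i
    rw [← hm, ← hf.nat_mul (d * m / n) (i + d * m % n), Nat.cast_id, add_assoc,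
      mul_comm (d * m / n), Nat.mod_add_div, mul_comm d m]
    exact hd.nat_mul m i
  · rwa [h]

lemma Function.Periodic.of_eventually {α : Type*} {f : ℕ → α} {i d n : ℕ}
    (hf : Function.Periodic f n) (hn : 0 < n) (h : ∀ m, f (i + m) = f (i + m + d)) :
    Function.Periodic f d := by
  intro m
  have hle : i ≤ m + i * n := (Nat.le_mul_of_pos_right i hn).trans (Nat.le_add_left _ _)
  have h1 := hf.nat_mul i
  have h2 := h (m + i * n - i)
  simp only [Nat.cast_id] at h1
  rw [Nat.add_sub_cancel' hle, add_right_comm, h1, h1] at h2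
  exact h2.symm

/-- If the edges form matchings, then a closed track with an aperiodic label has no repeated
vertices. -/
lemma IsClosedTrack.injective_of_isMatching {A B S : Type*} [Group A] [Group B] [LinearOrder S]
    {n : ℕ} (hn : 1 ≤ n) {a : ℕ → A} {b : ℕ → B} (hap : Function.Periodic a n)
    (hbp : Function.Periodic b n) {φA : A →* (S ≃o S)} {φB : B →* (S ≃o S)} {y z : ℕ → S}
    (h : IsClosedTrack n a b φA φB y z) (hA : IsMatching y z a)
    (hB : IsMatching z (fun i => y (i + 1)) b)
    (hab : ∀ e, e ∣ n → Function.Periodic a e → Function.Periodic b e → e = n) :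
    (∀ i j, y i = y j → i ≡ j [MOD n]) ∧ (∀ i j, z i = z j → i ≡ j [MOD n]) ∧
      ∀ i j, y i ≠ z j := by
  have hyp : Function.Periodic y n := h.periodic
  have hzp : Function.Periodic z n := fun i => by
    rw [h.left_step, h.left_step, hyp, hap]
  have hy : ∀ i d, y i = y (i + d) → n ∣ d := by
    intro i d hid
    have hshift : ∀ m, y (i + m) = y (i + m + d) := by
      intro m
      induction m with
      | zero => exact hid
      | succ m ih =>
        have := ((hB (i + m) (i + m + d)).1 ((hA _ _).1 ih).1).1
        rwa [← add_assoc, add_right_comm _ 1]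
    have had := hap.of_eventually hn fun m => ((hA _ _).1 (hshift m)).2
    have hbd := hbp.of_eventually hn fun m => ((hB _ _).1 ((hA _ _).1 (hshift m)).1).2
    rw [← hab _ (Nat.gcd_dvd_right d n) (periodic_gcd hn had hap) (periodic_gcd hn hbd hbp)]
    exact Nat.gcd_dvd_left d n
  have hy' : ∀ i j, y i = y j → i ≡ j [MOD n] := by
    intro i j hij
    rcases le_total i j with hle | hle
    · obtain ⟨d, rfl⟩ := Nat.exists_eq_add_of_le hle
      exact (Nat.modEq_iff_dvd' hle).2 (by simpa using hy i d hij)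
    · obtain ⟨d, rfl⟩ := Nat.exists_eq_add_of_le hle
      exact ((Nat.modEq_iff_dvd' hle).2 (by simpa using hy j d hij.symm)).symm
  refine ⟨hy', fun i j hij => hy' i j ((hA i j).2.1 hij).1, ?_⟩
  have hyz : ∀ k i, y i ≠ z (i + k) := by
    intro k
    induction k using Nat.twoStepInduction with
    | zero => exact fun i => (hA i i).2.2.2
    | one => exact fun i hi => (hB i i).2.2.2 ((hA i (i + 1)).2.2.1 hi)
    | more k ih _ =>
      intro i hi
      refine ih (i + 1) ?_
      have := (hB i (i + k + 1)).2.2.1 ((hA i (i + (k + 2))).2.2.1 hi)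
      rwa [add_right_comm]
  intro i j hij
  have hle : i ≤ j + i * n := (Nat.le_mul_of_pos_right i hn).trans (Nat.le_add_left _ _)
  refine hyz (j + i * n - i) i ?_
  rw [Nat.add_sub_cancel' hle, hij]
  exact (hzp.nat_mul i j).symm

/-- The list of letters `a 0, b 0, …, a (n - 1), b (n - 1)`. -/
def seqLetters {A B : Type*} [Group A] [Group B] (a : ℕ → A) (b : ℕ → B) (n : ℕ) :
    List (Monoid.Coprod A B) :=
  (List.range n).flatMap fun i => [Monoid.Coprod.inl (a i), Monoid.Coprod.inr (b i)]

section seqLetters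

variable {A B : Type*} [Group A] [Group B] (a : ℕ → A) (b : ℕ → B)

lemma wordLetters_eq_seqLetters (n : ℕ) :
    wordLetters (fun i : Fin n => a i) (fun i : Fin n => b i) = seqLetters a b n := by
  rw [wordLetters, seqLetters, ← List.map_coe_finRange_eq_range, List.flatMap_map]

lemma seqLetters_succ (n : ℕ) : seqLetters a b (n + 1) =
    seqLetters a b n ++ [Monoid.Coprod.inl (a n), Monoid.Coprod.inr (b n)] := by
  simp [seqLetters, List.range_succ]

lemma length_seqLetters (n : ℕ) : (seqLetters a b n).length = 2 * n := by
  induction n with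
  | zero => rfl
  | succ n ih => rw [seqLetters_succ, List.length_append, ih]; rfl

lemma seqLetters_prefix {m n : ℕ} (h : m ≤ n) : seqLetters a b m <+: seqLetters a b n := by
  induction n, h using Nat.le_induction with
  | base => exact List.prefix_rfl
  | succ n _ ih =>
    rw [seqLetters_succ]
    exact ih.trans (List.prefix_append _ _)

lemma take_even_seqLetters {m n : ℕ} (h : m ≤ n) :
    (seqLetters a b n).take (2 * m) = seqLetters a b m := by
  rw [List.prefix_iff_eq_take.1 (seqLetters_prefix a b h), length_seqLetters]

lemma take_odd_seqLetters {m n : ℕ} (h : m < n) :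
    (seqLetters a b n).take (2 * m + 1) = seqLetters a b m ++ [Monoid.Coprod.inl (a m)] := by
  have h1 := take_even_seqLetters a b (Nat.succ_le_of_lt h)
  rw [← min_eq_left (show 2 * m + 1 ≤ 2 * (m + 1) by omega), ← List.take_take, h1,
    seqLetters_succ, ← length_seqLetters a b m, List.take_length_add_append]
  rfl

lemma seqLetters_prod_mul {e : ℕ} (ha : Function.Periodic a e) (hb : Function.Periodic b e)
    (k : ℕ) : (seqLetters a b (e * k)).prod = (seqLetters a b e).prod ^ k := by
  induction k with
  | zero => rfl
  | succ k ih =>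
    rw [pow_succ', ← ih, Nat.mul_succ, add_comm, ← List.prod_append, seqLetters, List.range_add,
      List.flatMap_append, List.flatMap_map]
    simp only [add_comm e, ha _, hb _]
    rfl

end seqLetters

instance {A B : Type*} [Monoid A] [Monoid B] [Countable A] [Countable B] :
    Countable (Monoid.Coprod A B) :=
  have : Countable (FreeMonoid (A ⊕ B)) := inferInstanceAs (Countable (List (A ⊕ B)))
  Monoid.Coprod.mk_surjective.countable

/-- A word which is not a proper power has a relative stacking. -/
lemma exists_isRelativeStacking {A B : Type*} [Group A] [Group B] [Countable A] [Countable B]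
    (hA : IsRightOrderable A) (hB : IsRightOrderable B)
    {n : ℕ} (hn : 1 ≤ n) (a : Fin n → A) (b : Fin n → B)
    (ha : ∀ i, a i ≠ 1) (hb : ∀ i, b i ≠ 1)
    (hw : ¬ ∃ (v : Monoid.Coprod A B) (j : ℤ), 2 ≤ j ∧ (wordLetters a b).prod = v ^ j) :
    ∃ (σ : Monoid.Coprod A B → (ℝ ≃o ℝ)) (x : ℝ), IsRelativeStacking a b σ x := by
  obtain ⟨a', rfl, ha', hap⟩ : ∃ a' : ℕ → A, a = (fun i : Fin n => a' i) ∧ (∀ i, a' i ≠ 1) ∧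
      Function.Periodic a' n :=
    ⟨fun i => a ⟨i % n, Nat.mod_lt i hn⟩, by ext i; simp [Nat.mod_eq_of_lt i.2], fun i => ha _,
      fun i => by simp⟩
  obtain ⟨b', rfl, hb', hbp⟩ : ∃ b' : ℕ → B, b = (fun i : Fin n => b' i) ∧ (∀ i, b' i ≠ 1) ∧
      Function.Periodic b' n :=
    ⟨fun i => b ⟨i % n, Nat.mod_lt i hn⟩, by ext i; simp [Nat.mod_eq_of_lt i.2], fun i => hb _,
      fun i => by simp⟩
  rw [wordLetters_eq_seqLetters] at hw
  have hperiod : ∀ e, e ∣ n → Function.Periodic a' e → Function.Periodic b' e → e = n := by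
    rintro e ⟨k, rfl⟩ hae hbe
    by_contra hne
    refine hw ⟨(seqLetters a' b' e).prod, k, ?_, ?_⟩
    · have h0 : k ≠ 0 := by rintro rfl; omega
      have h1 : k ≠ 1 := by rintro rfl; omega
      omega
    · rw [zpow_natCast, seqLetters_prod_mul a' b' hae hbe]
  obtain ⟨S, _, φA, φB, y, z, h, hmA, hmB⟩ := exists_closedTrack_isMatching hA hB hn
    (a := fun i => (a' i)⁻¹) (b := fun i => (b' i)⁻¹) (fun i => inv_ne_one.2 (ha' i))
    (fun i => inv_ne_one.2 (hb' i)) (hap.comp Inv.inv) (hbp.comp Inv.inv)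
  obtain ⟨hy, hz, hyz⟩ := h.injective_of_isMatching hn (hap.comp Inv.inv)
    (hbp.comp Inv.inv) hmA hmB (fun e he h1 h2 => hperiod e he
      (fun i => inv_injective (h1 i)) (fun i => inv_injective (h2 i)))
  let φ : Monoid.Coprod A B →* (S ≃o S) := Monoid.Coprod.lift φA φB
  obtain ⟨Φ, hΦ⟩ := exists_real_action φ (y 0)
  have hodd : ∀ i, φ ((seqLetters a' b' i).prod * Monoid.Coprod.inl (a' i))⁻¹ (y 0) =
      φA (a' i)⁻¹ (φ (seqLetters a' b' i).prod⁻¹ (y 0)) := by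
    intro i
    rw [mul_inv_rev, map_mul, ← map_inv]
    simp [φ]
  have heven : ∀ i, φ (seqLetters a' b' i).prod⁻¹ (y 0) = y i := by
    intro i
    induction i with
    | zero => simp [seqLetters]
    | succ i ih =>
      have hsplit : (seqLetters a' b' (i + 1)).prod⁻¹ = Monoid.Coprod.inr (b' i)⁻¹ *
          ((seqLetters a' b' i).prod * Monoid.Coprod.inl (a' i))⁻¹ := by
        rw [seqLetters_succ, List.prod_append, map_inv]
        simp [mul_assoc]
      rw [hsplit, map_mul, RelIso.mul_apply, hodd, ih, ← h.left_step i, h.right_step i]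
      simp [φ]
  have hpt : ∀ m, 1 ≤ m → m ≤ 2 * n → ∃ i < n,
      (m = 2 * i + 1 ∧ φ ((seqLetters a' b' n).take m).prod⁻¹ (y 0) = z i) ∨
      (m = 2 * (i + 1) ∧ φ ((seqLetters a' b' n).take m).prod⁻¹ (y 0) = y (i + 1)) := by
    intro m h1 h2
    rcases Nat.even_or_odd' m with ⟨i, rfl | rfl⟩
    · refine ⟨i - 1, by omega, Or.inr ⟨by omega, ?_⟩⟩
      rw [take_even_seqLetters a' b' (by omega), heven, Nat.sub_add_cancel (by omega)]
    · refine ⟨i, by omega, Or.inl ⟨rfl, ?_⟩⟩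
      rw [take_odd_seqLetters a' b' (by omega), List.prod_append, List.prod_singleton, hodd, heven,
        ← h.left_step i]
  refine ⟨fun g => Φ g⁻¹, 0, ?_, ?_, ?_⟩
  · intro g k
    change Φ (g * k)⁻¹ = (Φ g⁻¹).trans (Φ k⁻¹)
    rw [mul_inv_rev, map_mul]
    rfl
  · rw [wordLetters_eq_seqLetters]
    have : Φ (seqLetters a' b' n).prod⁻¹ 0 = Φ 1 0 := by
      rw [hΦ, heven, map_one, ← zero_add n, h.periodic]
      rfl
    rwa [map_one] at this
  · intro m₁ m₂ h1 h2 h3 h4 heq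
    rw [wordLetters_eq_seqLetters, hΦ] at heq
    obtain ⟨i, hi, ⟨him, hi'⟩ | ⟨him, hi'⟩⟩ := hpt m₁ h1 h2 <;>
      obtain ⟨j, hj, ⟨hjm, hj'⟩ | ⟨hjm, hj'⟩⟩ := hpt m₂ h3 h4 <;>
      rw [hi', hj'] at heq
    · have := (hz _ _ heq).eq_of_lt_of_lt hi hj
      omega
    · exact absurd heq.symm (hyz _ _)
    · exact absurd heq (hyz _ _)
    · have := (Nat.ModEq.add_right_cancel' 1 (hy _ _ heq)).eq_of_lt_of_lt hi hj
      omega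

namespace Monoid.CoprodI

variable {ι : Type*} {M : ι → Type*} [∀ i, Group (M i)]

/-- The product of a list of letters. -/
def letterProd (l : List (Σ i, M i)) : CoprodI M :=
  (l.map fun p => of p.2).prod

lemma letterProd_append (l l' : List (Σ i, M i)) :
    letterProd (l ++ l') = letterProd l * letterProd l' := by
  simp [letterProd]

lemma Word.toList_eq_of_letterProd_eq {W W' : Word M}
    (h : letterProd W.toList = letterProd W'.toList) : W.toList = W'.toList := by
  classical
  exact congrArg Word.toList (Word.equiv.symm.injective (a₁ := W) (a₂ := W') h)

/-- Every list of letters that is not reduced has the same product as a shorter reduced one. -/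
lemma exists_word_letterProd_eq (l : List (Σ i, M i)) :
    ∃ W : Word M, letterProd W.toList = letterProd l ∧
      (W.toList = l ∨ W.toList.length < l.length) := by
  induction l with
  | nil => exact ⟨Word.empty, rfl, Or.inl rfl⟩
  | cons p t ih =>
    obtain ⟨⟨s, hne, hch⟩, hs, hlen⟩ := ih
    dsimp only at hs hlen
    have hle : s.length ≤ t.length := by
      rcases hlen with rfl | h
      exacts [le_rfl, h.le]
    have hcons : ∀ (q : Σ i, M i) (r : List (Σ i, M i)),
        letterProd (q :: r) = of q.2 * letterProd r := fun q r => by simp [letterProd]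
    by_cases hp : p.2 = 1
    · exact ⟨⟨s, hne, hch⟩, by rw [hcons, hs, hp, map_one, one_mul],
        Or.inr (Nat.lt_succ_of_le hle)⟩
    by_cases hhead : ∀ q ∈ s.head?, p.1 ≠ q.1
    · refine ⟨⟨p :: s, ?_, List.isChain_cons.2 ⟨hhead, hch⟩⟩, by rw [hcons, hcons, hs], ?_⟩
      · exact List.forall_mem_cons.2 ⟨hp, hne⟩
      · rcases hlen with rfl | h
        exacts [Or.inl rfl, Or.inr (Nat.succ_lt_succ h)]
    · push Not at hhead
      obtain ⟨q, hq, hpq⟩ := hhead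
      obtain ⟨r, rfl⟩ := List.head?_eq_some_iff.1 hq
      obtain ⟨i, x⟩ := p
      obtain ⟨j, y⟩ := q
      obtain rfl : i = j := hpq
      obtain ⟨hch1, hch2⟩ := List.isChain_cons.1 hch
      have hne2 : ∀ l ∈ r, l.2 ≠ 1 := fun l hl => hne l (List.mem_cons_of_mem _ hl)
      rw [hcons] at hs
      by_cases hxy : x * y = 1
      · refine ⟨⟨r, hne2, hch2⟩, ?_, Or.inr ?_⟩
        · rw [hcons, ← hs, ← mul_assoc, ← map_mul, hxy, map_one, one_mul]
        · simp only [List.length_cons] at hle ⊢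
          omega
      · refine ⟨⟨⟨i, x * y⟩ :: r, ?_, List.isChain_cons.2 ⟨hch1, hch2⟩⟩, ?_, Or.inr ?_⟩
        · exact List.forall_mem_cons.2 ⟨hxy, hne2⟩
        · rw [hcons, hcons, ← hs, ← mul_assoc, ← map_mul]
        · simp only [List.length_cons] at hle ⊢
          omega

lemma append_comm_of_reduced {l l' : List (Σ i, M i)} (hne : ∀ p ∈ l ++ l', p.2 ≠ 1)
    (hch : (l ++ l').IsChain fun p q => p.1 ≠ q.1)
    (h : letterProd l * letterProd l' = letterProd l' * letterProd l) : l ++ l' = l' ++ l := by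
  obtain ⟨W, hW, hWl⟩ := exists_word_letterProd_eq (l' ++ l)
  have heq : (l ++ l') = W.toList :=
    Word.toList_eq_of_letterProd_eq (W := ⟨l ++ l', hne, hch⟩) (by
      rw [hW, letterProd_append, letterProd_append, h])
  rcases hWl with hWl | hWl
  · rw [heq, hWl]
  · rw [← heq, List.length_append, List.length_append] at hWl
    omega

/-- A root of a cyclically reduced word with distinct first and last factors is the product of a
proper prefix. -/
lemma Word.exists_letterProd_take_eq_of_pow {w : Word M} (hw : w.toList ≠ [])
    (hcyc : ∀ p ∈ w.toList.getLast?, ∀ q ∈ w.toList.head?, p.1 ≠ q.1) {v : CoprodI M} {j : ℕ}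
    (hj : 2 ≤ j) (hv : letterProd w.toList = v ^ j) :
    ∃ m, 1 ≤ m ∧ m < w.toList.length ∧ v = letterProd (w.toList.take m) := by
  classical
  obtain ⟨V, rfl⟩ := Word.equiv.symm.surjective v
  change letterProd w.toList = letterProd V.toList ^ j at hv
  change ∃ m, 1 ≤ m ∧ m < w.toList.length ∧ letterProd V.toList = _
  have hV : V.toList ≠ [] := by
    intro h
    rw [h] at hv
    refine hw (Word.toList_eq_of_letterProd_eq (W' := Word.empty) ?_)
    rw [hv]
    exact one_pow j
  have hcomm : letterProd V.toList * letterProd w.toList =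
      letterProd w.toList * letterProd V.toList := by
    rw [hv, ← pow_succ, ← pow_succ']
  by_cases hVcyc : ∀ p ∈ V.toList.getLast?, ∀ q ∈ V.toList.head?, p.1 ≠ q.1
  · have hpow : ∀ k, letterProd (List.replicate k V.toList).flatten = letterProd V.toList ^ k := by
      intro k
      induction k with
      | zero => simp [letterProd]
      | succ k ih => rw [List.replicate_succ, List.flatten_cons, letterProd_append, ih, pow_succ']
    have hred : (List.replicate j V.toList).flatten.IsChain fun p q => p.1 ≠ q.1 := by
      rw [List.isChain_flatten (by simp [List.mem_replicate, hV.symm])]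
      refine ⟨fun l hl => (List.eq_of_mem_replicate hl) ▸ V.chain_ne, ?_⟩
      exact List.isChain_replicate_of_rel _ hVcyc
    have heq : (List.replicate j V.toList).flatten = w.toList :=
      Word.toList_eq_of_letterProd_eq (W := ⟨_, fun l hl => by
        obtain ⟨s, hs, hl⟩ := List.mem_flatten.1 hl
        rw [List.eq_of_mem_replicate hs] at hl
        exact V.ne_one l hl, hred⟩) (by rw [hv]; exact hpow j)
    obtain ⟨k, rfl⟩ := Nat.exists_eq_add_of_le' hj
    have hpos := List.length_pos_iff.2 hV
    rw [List.replicate_succ, List.flatten_cons, List.replicate_succ, List.flatten_cons] at heq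
    refine ⟨V.toList.length, hpos, ?_, ?_⟩
    · rw [← heq, List.length_append, List.length_append]
      omega
    · rw [← heq, List.take_left]
  · push Not at hVcyc
    obtain ⟨x, hx, y, hy, hxy⟩ := hVcyc
    obtain ⟨p, hp⟩ : ∃ p, w.toList.head? = some p := ⟨_, List.head?_eq_some_head hw⟩
    obtain ⟨q, hq⟩ : ∃ q, w.toList.getLast? = some q := ⟨_, List.getLast?_eq_some_getLast hw⟩
    have hpq := hcyc q hq p hp
    exfalso
    by_cases hxp : x.1 = p.1
    · have h := append_comm_of_reduced (l := w.toList) (l' := V.toList)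
        (fun p hp => (List.mem_append.1 hp).elim (w.ne_one p) (V.ne_one p))
        (List.isChain_append.2 ⟨w.chain_ne, V.chain_ne, fun a ha b hb => by
          obtain rfl := Option.mem_unique ha hq
          obtain rfl := Option.mem_unique hb hy
          rwa [← hxy, hxp]⟩) hcomm.symm
      have h2 := congrArg List.getLast? h
      rw [List.getLast?_append, List.getLast?_append, hq, Option.mem_def.1 hx] at h2
      simp only [Option.some_or, Option.some.injEq] at h2
      exact hpq (by rw [← h2, hxp])
    · have h := append_comm_of_reduced (l := V.toList) (l' := w.toList)
        (fun p hp => (List.mem_append.1 hp).elim (V.ne_one p) (w.ne_one p))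
        (List.isChain_append.2 ⟨V.chain_ne, w.chain_ne, fun a ha b hb => by
          obtain rfl := Option.mem_unique ha hx
          obtain rfl := Option.mem_unique hb hp
          exact hxp⟩) hcomm
      have h2 := congrArg List.head? h
      rw [List.head?_append, List.head?_append, hp, Option.mem_def.1 hy] at h2
      simp only [Option.some_or, Option.some.injEq] at h2
      exact hxp (by rw [hxy, h2])

end Monoid.CoprodI

section FreeFactors

universe u v

variable {A : Type u} {B : Type v}

/-- The two free factors, as a family of groups in one universe. -/
def FreeFactor (A : Type u) (B : Type v) : Bool → Type (max u v)
  | true => ULift.{v} A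
  | false => ULift.{u} B

/-- The letters of a word in the binary free product, as letters of the indexed free product. -/
def factorLetters (a : ℕ → A) (b : ℕ → B) (n : ℕ) : List (Σ i, FreeFactor A B i) :=
  (List.range n).flatMap fun i => [⟨true, ULift.up (a i)⟩, ⟨false, ULift.up (b i)⟩]

lemma factorLetters_succ (a : ℕ → A) (b : ℕ → B) (n : ℕ) : factorLetters a b (n + 1) =
    factorLetters a b n ++ [⟨true, ULift.up (a n)⟩, ⟨false, ULift.up (b n)⟩] := by
  simp [factorLetters, List.range_succ]

lemma head_factorLetters (a : ℕ → A) (b : ℕ → B) (n : ℕ) :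
    ∀ p ∈ (factorLetters a b n).head?, p.1 = true := by
  cases n with
  | zero => simp [factorLetters]
  | succ n => simp [factorLetters, List.range_succ_eq_map]

lemma getLast_factorLetters (a : ℕ → A) (b : ℕ → B) (n : ℕ) :
    ∀ p ∈ (factorLetters a b n).getLast?, p.1 = false := by
  cases n with
  | zero => simp [factorLetters]
  | succ n => simp [factorLetters_succ]

variable [Group A] [Group B]

instance : ∀ i, Group (FreeFactor A B i)
  | true => inferInstanceAs (Group (ULift.{v} A))
  | false => inferInstanceAs (Group (ULift.{u} B))

/-- The inclusion of a letter into the binary free product. -/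
def letterHom : ∀ i, FreeFactor A B i →* Monoid.Coprod A B
  | true => Monoid.Coprod.inl.comp (MulEquiv.ulift (α := A)).toMonoidHom
  | false => Monoid.Coprod.inr.comp (MulEquiv.ulift (α := B)).toMonoidHom

lemma map_factorLetters (a : ℕ → A) (b : ℕ → B) (n : ℕ) :
    (factorLetters a b n).map (fun p => letterHom p.1 p.2) = seqLetters a b n := by
  rw [factorLetters, List.map_flatMap]
  rfl

/-- The reduced word with letters `a 0, b 0, …, a (n - 1), b (n - 1)`. -/
def factorWord (a : ℕ → A) (b : ℕ → B) (n : ℕ) (ha : ∀ i < n, a i ≠ 1) (hb : ∀ i < n, b i ≠ 1) :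
    Monoid.CoprodI.Word (FreeFactor A B) where
  toList := factorLetters a b n
  ne_one := by
    intro l hl
    simp only [factorLetters, List.mem_flatMap, List.mem_range, List.mem_cons,
      List.not_mem_nil, or_false] at hl
    obtain ⟨i, hi, rfl | rfl⟩ := hl
    · exact fun h => ha i hi (congrArg ULift.down h)
    · exact fun h => hb i hi (congrArg ULift.down h)
  chain_ne := by
    clear ha hb
    induction n with
    | zero => exact List.isChain_nil
    | succ n ih =>
      rw [factorLetters_succ]
      refine List.isChain_append.2 ⟨ih, by simp, ?_⟩
      intro p hp q hq
      rw [getLast_factorLetters a b n p hp]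
      simp only [List.head?_cons, Option.mem_def, Option.some.injEq] at hq
      simp [← hq]

/-- A root of a cyclically reduced word is a proper prefix of it. -/
lemma exists_take_prod_eq_of_prod_eq_pow {n : ℕ} (hn : 1 ≤ n) {a : ℕ → A} {b : ℕ → B}
    (ha : ∀ i < n, a i ≠ 1) (hb : ∀ i < n, b i ≠ 1) {v : Monoid.Coprod A B} {j : ℕ} (hj : 2 ≤ j)
    (hv : (seqLetters a b n).prod = v ^ j) :
    ∃ m, 1 ≤ m ∧ m < 2 * n ∧ v = ((seqLetters a b n).take m).prod := by
  let e : Monoid.CoprodI (FreeFactor A B) →* Monoid.Coprod A B := Monoid.CoprodI.lift letterHom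
  let f : Monoid.Coprod A B →* Monoid.CoprodI (FreeFactor A B) := Monoid.Coprod.lift
    ((Monoid.CoprodI.of (M := FreeFactor A B) (i := true)).comp
      (MulEquiv.ulift (α := A)).symm.toMonoidHom)
    ((Monoid.CoprodI.of (M := FreeFactor A B) (i := false)).comp
      (MulEquiv.ulift (α := B)).symm.toMonoidHom)
  have hef : ∀ g, e (f g) = g := by
    have : e.comp f = MonoidHom.id _ := by
      ext x <;> simp [e, f] <;> rfl
    exact DFunLike.congr_fun this
  have he : ∀ l, e (Monoid.CoprodI.letterProd l) = (l.map fun p => letterHom p.1 p.2).prod := by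
    intro l
    simp [e, Monoid.CoprodI.letterProd, map_list_prod, Function.comp_def]
  have hf : f (seqLetters a b n).prod = Monoid.CoprodI.letterProd (factorLetters a b n) := by
    rw [map_list_prod, seqLetters, List.map_flatMap, Monoid.CoprodI.letterProd, factorLetters,
      List.map_flatMap]
    simp [f]
    rfl
  have hlen : (factorLetters a b n).length = 2 * n := by
    rw [← length_seqLetters a b n, ← map_factorLetters, List.length_map]
  obtain ⟨m, h1, h2, h3⟩ := Monoid.CoprodI.Word.exists_letterProd_take_eq_of_pow
    (w := factorWord a b n ha hb) (v := f v) (List.ne_nil_of_length_pos (by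
      change 0 < (factorLetters a b n).length
      omega))
    (fun p hp q hq => by
      rw [getLast_factorLetters a b n p hp, head_factorLetters a b n q hq]
      exact Bool.false_ne_true) hj (by
      change Monoid.CoprodI.letterProd (factorLetters a b n) = _
      rw [← hf, hv, map_pow])
  refine ⟨m, h1, hlen ▸ h2, ?_⟩
  rw [← hef v, h3, he, List.map_take, ← map_factorLetters]
  rfl

end FreeFactors

lemma IsRightAction.apply_pow {G : Type*} [Group G] {σ : G → (ℝ ≃o ℝ)} (hσ : IsRightAction σ)
    (v : G) (k : ℕ) (x : ℝ) : σ (v ^ (k + 1)) x = (σ v)^[k + 1] x := by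
  induction k with
  | zero => simp
  | succ k ih =>
    rw [pow_succ, hσ, OrderIso.trans_apply, ih, Function.iterate_succ_apply' _ (k + 1)]

/-- For a cyclically reduced word `w = a₁b₁⋯aₙbₙ` in a free product of countable
right-orderable groups, a relative stacking of `w` exists iff `w` is not a proper power. -/
theorem relativeStacking_exists_iff_not_properPower
    {A B : Type*} [Group A] [Group B] [Countable A] [Countable B]
    (hA : IsRightOrderable A) (hB : IsRightOrderable B)
    {n : ℕ} (hn : 1 ≤ n) (a : Fin n → A) (b : Fin n → B)
    (ha : ∀ i, a i ≠ 1) (hb : ∀ i, b i ≠ 1) :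
    (∃ (σ : Monoid.Coprod A B → (ℝ ≃o ℝ)) (x : ℝ), IsRelativeStacking a b σ x) ↔
      ¬ ∃ (v : Monoid.Coprod A B) (j : ℤ), 2 ≤ j ∧ (wordLetters a b).prod = v ^ j := by
  refine ⟨?_, exists_isRelativeStacking hA hB hn a b ha hb⟩
  rintro ⟨σ, x, hσ, hfix, hinj⟩ ⟨v, j, hj, hv⟩
  obtain ⟨j, rfl⟩ := Int.eq_ofNat_of_zero_le (by omega : 0 ≤ j)
  rw [zpow_natCast] at hv
  obtain ⟨k, rfl⟩ : ∃ k, j = k + 1 := ⟨j - 1, by omega⟩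
  obtain ⟨a', rfl⟩ : ∃ a' : ℕ → A, a = fun i : Fin n => a' i :=
    ⟨fun i => if h : i < n then a ⟨i, h⟩ else 1, by ext i; simp⟩
  obtain ⟨b', rfl⟩ : ∃ b' : ℕ → B, b = fun i : Fin n => b' i :=
    ⟨fun i => if h : i < n then b ⟨i, h⟩ else 1, by ext i; simp⟩
  rw [wordLetters_eq_seqLetters] at hv hfix hinj
  obtain ⟨m, h1, h2, rfl⟩ := exists_take_prod_eq_of_prod_eq_pow hn (fun i hi => ha ⟨i, hi⟩)
    (fun i hi => hb ⟨i, hi⟩) (by omega) hv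
  have hroot : σ ((seqLetters a' b' n).take m).prod x = x := by
    rw [hv, hσ.apply_pow] at hfix
    have hmono := (σ ((seqLetters a' b' n).take m).prod).strictMono
    exact (Function.Commute.id_right.iterate_pos_eq_iff_map_eq hmono.monotone strictMono_id
      k.succ_pos).1 (by simpa using hfix)
  have := hinj m (2 * n) h1 h2.le (by omega) le_rfl (by
    rw [hroot, List.take_of_length_le (length_seqLetters a' b' n).le, hfix])
  omega
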